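/- arXiv:1807.11523 — 2 statements merged into one kernel-verified Lean document; each statement's English description precedes it below -/
import Mathlib

section
/- Let H be a monoid such that the reduced quotient H_red = H/H^× is finitely generated and min R̄(H) < max R̄(H). Let c ∈ H be a nonunit with lim_{n→∞} ρ(c^n) = max R̄(H) and let b ∈ A(H) be an atom with lim_{n→∞} ρ(b^n) = min R̄(H). Then there exists M ∈ ℕ with the following property: for every k ∈ ℕ and every ℓ ∈ ℕ₀ there exist ℓ_1, …, ℓ_k ∈ ℤ with ℓ_1 + … + ℓ_k = ℓ such that c^M b^{ℓ_i} ∈ H for all i (as elements of the quotient group q(H)), max L(c^{kM} b^ℓ) = Σ_{i=1}^{k} max L(c^M b^{ℓ_i}), and min L(c^{kM} b^ℓ) = Σ_{i=1}^{k} min L(c^M b^{ℓ_i}). -/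
open Filter Topology

/-- The set of factorization lengths of `a`: the set of all `k` such that `a` is a
product of `k` atoms (irreducibles); by convention it is `{0}` for units. -/
noncomputable def lengthSet (H : Type*) [CommMonoid H] (a : H) : Set ℕ :=
  open Classical in
  if IsUnit a then {0}
  else {k | ∃ f : Fin k → H, (∀ i, Irreducible (f i)) ∧ a = ∏ i, f i}

/-- The elasticity `ρ(a) = max L(a) / min L(a)` of an element of a BF-monoid,
with `ρ(a) = 1` for units. -/
noncomputable def elasticity (H : Type*) [CommMonoid H] (a : H) : ℝ :=
  open Classical in
  if IsUnit a then 1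
  else ((sSup (lengthSet H a) : ℕ) : ℝ) / ((sInf (lengthSet H a) : ℕ) : ℝ)

/-- The elasticity `ρ(H) = sup {ρ(a) : a ∈ H} ∈ ℝ≥1 ∪ {∞}` of the monoid `H`. -/
noncomputable def monoidElasticity (H : Type*) [CommMonoid H] : EReal :=
  ⨆ a : H, ((elasticity H a : ℝ) : EReal)

/-- The set `R̄(H)` of asymptotic elasticities `ρ̄(a) = lim_{n → ∞} ρ(aⁿ)`
of nonunits `a ∈ H` (membership requires the limit to exist). -/
def asympSet (H : Type*) [CommMonoid H] : Set EReal :=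
  {r | ∃ a : H, ¬ IsUnit a ∧
    Tendsto (fun n : ℕ => ((elasticity H (a ^ n) : ℝ) : EReal)) atTop (nhds r)}

/-- `H` is locally finitely generated: for every `a ∈ H` there are only finitely many
atoms, up to associates, dividing some power of `a`. -/
def LocallyFinitelyGenerated (H : Type*) [CommMonoid H] : Prop :=
  ∀ a : H, {u : Associates H | Irreducible u ∧ ∃ n : ℕ, u ∣ Associates.mk (a ^ n)}.Finite

/-- `H` is a BF-monoid: atomic (every nonunit has a factorization into atoms) and
all sets of lengths are finite. -/
def IsBFMonoid (H : Type*) [CommMonoid H] : Prop :=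
  (∀ a : H, ¬ IsUnit a → (lengthSet H a).Nonempty) ∧ ∀ a : H, (lengthSet H a).Finite

/-- `(k, ℓ) ≠ (0,0)` is a nice pair with respect to `(a, b)` if
`max L((aᵏbˡ)ᵗ) = t · max L(aᵏbˡ)` and `min L((aᵏbˡ)ᵗ) = t · min L(aᵏbˡ)` for all `t ∈ ℕ`. -/
def IsNicePair (H : Type*) [CommMonoid H] (a b : H) (k ℓ : ℕ) : Prop :=
  ¬ (k = 0 ∧ ℓ = 0) ∧ ∀ t : ℕ, 0 < t →
    sSup (lengthSet H ((a ^ k * b ^ ℓ) ^ t)) = t * sSup (lengthSet H (a ^ k * b ^ ℓ)) ∧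
    sInf (lengthSet H ((a ^ k * b ^ ℓ) ^ t)) = t * sInf (lengthSet H (a ^ k * b ^ ℓ))

/-- `H` is strongly primary: `H ≠ H^×` and for every nonunit `a` there is `n ∈ ℕ`
such that every product of `n` nonunits of `H` is divisible by `a`. -/
def StronglyPrimary (H : Type*) [CommMonoid H] : Prop :=
  (∃ a : H, ¬ IsUnit a) ∧ ∀ a : H, ¬ IsUnit a → ∃ n : ℕ, 0 < n ∧
    ∀ f : Fin n → H, (∀ i, ¬ IsUnit (f i)) → a ∣ ∏ i, f i

/-- `H` is half-factorial: atomic and `|L(a)| = 1` for every `a ∈ H`. -/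
def IsHalfFactorial (H : Type*) [CommMonoid H] : Prop :=
  ∀ a : H, ∃ k : ℕ, lengthSet H a = {k}

section Dickson

/-- A divisor-closed (subtractive) submonoid of a well-quasi-ordered cancellative additive monoid
is generated by finitely many of its elements. -/
theorem AddSubmonoid.exists_finite_multiset_sum_of_subtractive {T : Type*} [AddCommMonoid T]
    [PartialOrder T] [IsCancelAdd T] [CanonicallyOrderedAdd T] [WellQuasiOrderedLE T] (S : AddSubmonoid T)
    (hS : ∀ x y, x ∈ S → x + y ∈ S → y ∈ S) :
    ∃ B : Set T, B.Finite ∧ ∀ x ∈ S, ∃ s : Multiset T, (∀ y ∈ s, y ∈ B ∧ y ∈ S) ∧ s.sum = x := by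
  refine ⟨{x | Minimal (fun x => x ∈ S ∧ x ≠ 0) x},
    WellQuasiOrderedLE.finite_of_isAntichain (setOfPred_minimal_antichain _), fun x => ?_⟩
  induction x using WellFoundedLT.induction with
  | ind x ih =>
    intro hx
    by_cases hx0 : x = 0
    · exact ⟨0, by simp, by simp [hx0]⟩
    obtain ⟨y, hyx, hy⟩ := exists_minimal_le_of_wellFoundedLT (fun x => x ∈ S ∧ x ≠ 0) x ⟨hx, hx0⟩
    obtain ⟨z, rfl⟩ := le_iff_exists_add.1 hyx
    have hz : z ∈ S := hS y z hy.prop.1 hx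
    have hle : z ≤ y + z := le_add_self
    rcases hle.lt_or_eq with hlt | heq
    · obtain ⟨s, hs, hsum⟩ := ih z hlt hz
      refine ⟨y ::ₘ s, ?_, by simp [hsum]⟩
      intro t ht
      rcases Multiset.mem_cons.1 ht with rfl | ht
      · exact ⟨hy, hy.prop.1⟩
      · exact hs t ht
    · have hy0 : y = 0 := add_eq_right.1 heq.symm
      exact absurd hy0 hy.prop.2

end Dickson

section Grouping

variable {T : Type*} (w : T → ℕ)

theorem Multiset.exists_le_sum_map_eq_factorial {N : ℕ} (s : Multiset T) (hs : ∀ x ∈ s, w x ≤ N)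
    (h : N * N.factorial ≤ (s.map w).sum) (hN : 0 < N) :
    ∃ t ≤ s, (t.map w).sum = N.factorial := by
  classical
  have key : (s.map w).sum = ∑ n ∈ Finset.Icc 1 N, n * (s.filter (fun x => w x = n)).card := by
    clear h
    induction s using Multiset.induction with
    | empty => simp
    | cons a s ih =>
      have hsum : ∀ n, n * ((a ::ₘ s).filter (fun x => w x = n)).card =
          (if w a = n then n else 0) + n * (s.filter (fun x => w x = n)).card := by
        intro n
        split_ifs with hn
        · rw [Multiset.filter_cons_of_pos (p := fun x => w x = n) _ hn, Multiset.card_cons]; ring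
        · rw [Multiset.filter_cons_of_neg (p := fun x => w x = n) _ hn, zero_add]
      rw [Multiset.map_cons, Multiset.sum_cons,
        ih fun x hx => hs x (Multiset.mem_cons_of_mem hx),
        Finset.sum_congr rfl fun n _ => hsum n, Finset.sum_add_distrib, Finset.sum_ite_eq]
      have := hs a (Multiset.mem_cons_self a s)
      congr 1
      split_ifs with h1
      · rfl
      · simp only [Finset.mem_Icc, not_and_or] at h1
        omega
  obtain ⟨n, hn, hle⟩ : ∃ n ∈ Finset.Icc 1 N,
      N.factorial ≤ n * (s.filter (fun x => w x = n)).card := by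
    apply Finset.exists_le_of_sum_le (Finset.nonempty_Icc.2 hN)
    rw [← key]
    simpa using h
  rw [Finset.mem_Icc] at hn
  obtain ⟨q, hq⟩ := Nat.dvd_factorial hn.1 hn.2
  have hqc : q ≤ (s.filter (fun x => w x = n)).card := by
    rw [hq] at hle
    exact Nat.le_of_mul_le_mul_left hle hn.1
  obtain ⟨t, ht, hcard⟩ : ∃ t ≤ s.filter (fun x => w x = n), t.card = q := by
    obtain ⟨l, hl⟩ := Quot.exists_rep (s.filter (fun x => w x = n))
    rw [← hl] at hqc ⊢
    exact ⟨l.take q, (l.take_sublist q).subperm, by simpa using hqc⟩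
  refine ⟨t, ht.trans (Multiset.filter_le _ _), ?_⟩
  have : t.map w = Multiset.replicate q n := by
    rw [Multiset.eq_replicate]
    refine ⟨by simp [hcard], fun b hb => ?_⟩
    obtain ⟨x, hx, rfl⟩ := Multiset.mem_map.1 hb
    exact (Multiset.mem_filter.1 (Multiset.mem_of_le ht hx)).2
  rw [this, Multiset.sum_replicate, hq, smul_eq_mul, mul_comm]

theorem Multiset.exists_le_sum_map_eq_mul_factorial {N : ℕ} (hN : 0 < N) (j : ℕ) (s : Multiset T)
    (hs : ∀ x ∈ s, w x ≤ N) (h : N * N.factorial + j * N.factorial ≤ (s.map w).sum) :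
    ∃ t ≤ s, (t.map w).sum = j * N.factorial := by
  induction j generalizing s with
  | zero => exact ⟨0, zero_le _, by simp⟩
  | succ j ih =>
    obtain ⟨t, ht, htw⟩ := s.exists_le_sum_map_eq_factorial w hs (by omega) hN
    obtain ⟨r, rfl⟩ := Multiset.le_iff_exists_add.1 ht
    rw [Multiset.map_add, Multiset.sum_add, htw, add_one_mul] at h
    obtain ⟨t', ht', htw'⟩ := ih r (fun x hx => hs x (by simp [hx])) (by omega)
    refine ⟨t + t', by gcongr, ?_⟩
    rw [Multiset.map_add, Multiset.sum_add, htw, htw']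
    ring

/-- A multiset with weights at most `N` and total weight `k * (N * N!)` splits into `k` parts of
weight `N * N!`. -/
theorem Multiset.exists_sum_eq_of_sum_map_eq_mul {N : ℕ} (hN : 0 < N) (k : ℕ) (hk : 0 < k)
    (s : Multiset T) (hs : ∀ x ∈ s, w x ≤ N) (h : (s.map w).sum = k * (N * N.factorial)) :
    ∃ g : Fin k → Multiset T, ∑ i, g i = s ∧ ∀ i, ((g i).map w).sum = N * N.factorial := by
  induction k, hk using Nat.le_induction generalizing s with
  | base => exact ⟨fun _ => s, by simp, fun _ => by simpa using h⟩
  | succ k hk ih =>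
    have hk' : N * N.factorial ≤ k * (N * N.factorial) := Nat.le_mul_of_pos_left _ hk
    obtain ⟨t, ht, htw⟩ := s.exists_le_sum_map_eq_mul_factorial w hN N hs
      (by rw [h, add_one_mul]; omega)
    obtain ⟨r, rfl⟩ := Multiset.le_iff_exists_add.1 ht
    rw [Multiset.map_add, Multiset.sum_add, htw, add_one_mul] at h
    obtain ⟨g, hg, hgw⟩ := ih r (fun x hx => hs x (by simp [hx])) (by omega)
    refine ⟨Fin.cons t g, by simp [Fin.sum_univ_succ, hg], fun i => ?_⟩
    refine Fin.cases ?_ (fun i => ?_) i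
    · simpa using htw
    · simpa using hgw i

end Grouping

section Factorization

variable (H : Type*) [CancelCommMonoid H]

instance Associates.instCancelCommMonoidOfCancel : CancelCommMonoid (Associates H) :=
  { (inferInstance : CommMonoid (Associates H)) with
    mul_left_cancel := by
      intro a b c h
      induction a using Quotient.inductionOn
      induction b using Quotient.inductionOn
      induction c using Quotient.inductionOn
      rename_i a b c
      have h' : Associates.mk (a * b) = Associates.mk (a * c) := h
      rw [Associates.mk_eq_mk_iff_associated] at h'
      obtain ⟨u, hu⟩ := h'
      refine Associates.mk_eq_mk_iff_associated.2 ⟨u, ?_⟩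
      rw [mul_assoc] at hu
      exact mul_left_cancel hu }

variable {H} in
theorem irreducible_associatesMk_iff {a : H} : Irreducible (Associates.mk a) ↔ Irreducible a := by
  simp only [irreducible_iff, Associates.isUnit_mk, Associates.forall_associated,
    Associates.mk_mul_mk]
  refine and_congr_right fun _ => ⟨fun h x y hxy => h x y (by rw [hxy]), fun h x y hxy => ?_⟩
  obtain ⟨v, hv⟩ := Associates.mk_eq_mk_iff_associated.1 hxy.symm
  rcases h (a := x) (b := y * v) (by rw [← hv, mul_assoc]) with h | h
  · exact .inl h
  · exact .inr (isUnit_of_mul_isUnit_left h)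

/-- The atoms of the reduced monoid `H_red`. -/
abbrev ReducedAtom : Type _ := {u : Associates H // Irreducible u}

variable {H}

/-- The product in `H_red` of a formal factorization. -/
def factorizationProd : Multiplicative (Multiset (ReducedAtom H)) →* Associates H where
  toFun s := (s.toAdd.map Subtype.val).prod
  map_one' := by simp
  map_mul' := by simp

theorem factorizationProd_ofAdd (s : Multiset (ReducedAtom H)) :
    factorizationProd (.ofAdd s) = (s.map Subtype.val).prod := rfl

theorem factorizationProd_add (s t : Multiset (ReducedAtom H)) :
    factorizationProd (.ofAdd (s + t)) =
      factorizationProd (.ofAdd s) * factorizationProd (.ofAdd t) :=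
  map_mul factorizationProd (.ofAdd s) (.ofAdd t)

theorem eq_zero_of_factorizationProd_eq_one {s : Multiset (ReducedAtom H)}
    (h : factorizationProd (.ofAdd s) = 1) : s = 0 := by
  refine Multiset.eq_zero_of_forall_notMem fun u hu => u.2.not_isUnit ?_
  refine isUnit_of_dvd_one (h ▸ Multiset.dvd_prod (Multiset.mem_map_of_mem _ hu))

theorem exists_factorizationProd_eq (hfg : Monoid.FG (Associates H)) (x : Associates H) :
    ∃ s : Multiset (ReducedAtom H), factorizationProd (.ofAdd s) = x := by
  have hx : x ∈ Submonoid.closure {p : Associates H | Irreducible p} := by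
    rw [Submonoid.closure_irreducible]; trivial
  induction hx using Submonoid.closure_induction with
  | mem x hx => exact ⟨{⟨x, hx⟩}, by simp [factorizationProd_ofAdd]⟩
  | one => exact ⟨0, by simp⟩
  | mul x y _ _ hx hy =>
    obtain ⟨s, rfl⟩ := hx
    obtain ⟨t, rfl⟩ := hy
    exact ⟨s + t, factorizationProd_add s t⟩

theorem wellQuasiOrderedLE_multiset_reducedAtom (hfg : Monoid.FG (Associates H)) :
    WellQuasiOrderedLE (Multiset (ReducedAtom H)) := by
  classical
  have : Finite (ReducedAtom H) := (finite_irreducible (M := Associates H)).to_subtype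
  exact Finsupp.orderIsoMultiset.wellQuasiOrderedLE_iff.1 inferInstance

theorem finite_setOf_factorizationProd_eq (hfg : Monoid.FG (Associates H)) (x : Associates H) :
    {s : Multiset (ReducedAtom H) | factorizationProd (.ofAdd s) = x}.Finite := by
  have := wellQuasiOrderedLE_multiset_reducedAtom hfg
  refine WellQuasiOrderedLE.finite_of_isAntichain ?_
  intro s hs t ht hne hle
  obtain ⟨u, rfl⟩ := Multiset.le_iff_exists_add.1 hle
  simp only [Set.mem_ofPred_eq, factorizationProd_add] at hs ht
  rw [hs, mul_eq_left] at ht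
  exact hne (by simp [eq_zero_of_factorizationProd_eq_one ht])

theorem mem_lengthSet_iff (a : H) (k : ℕ) :
    k ∈ lengthSet H a ↔ ∃ s : Multiset (ReducedAtom H),
      s.card = k ∧ factorizationProd (.ofAdd s) = Associates.mk a := by
  unfold lengthSet
  split_ifs with ha
  · rw [Associates.mk_eq_one.2 ha]
    constructor
    · rintro rfl
      exact ⟨0, rfl, by simp⟩
    · rintro ⟨s, rfl, hs⟩
      simp [eq_zero_of_factorizationProd_eq_one hs]
  · constructor
    · rintro ⟨f, hf, rfl⟩
      refine ⟨Finset.univ.val.map fun i => ⟨Associates.mk (f i), irreducible_associatesMk_iff.2 (hf i)⟩,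
        by simp, ?_⟩
      simp only [factorizationProd_ofAdd, Multiset.map_map,
        Function.comp_def]
      exact (map_prod Associates.mkMonoidHom f Finset.univ).symm
    · rintro ⟨s, rfl, hs⟩
      induction s using Quotient.inductionOn with
      | h l =>
      choose r hr using fun u : Associates H => Associates.exists_rep u
      have hirr : ∀ u : ReducedAtom H, Irreducible (r u) := fun u =>
        irreducible_associatesMk_iff.1 ((hr u).symm ▸ u.2)
      have hass : Associates.mk ((l.map fun u => r u.1).prod) = Associates.mk a := by
        rw [← hs]
        simp only [factorizationProd_ofAdd, Multiset.quot_mk_to_coe, Multiset.map_coe, Multiset.prod_coe]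
        have := map_list_prod (Associates.mkMonoidHom (M := H)) (l.map fun u => r u.1)
        simpa [Function.comp_def, hr] using this
      obtain ⟨v, hv⟩ := Associates.mk_eq_mk_iff_associated.1 hass
      cases l with
      | nil => exact absurd ⟨v, by simpa using hv⟩ ha
      | cons u l =>
        refine ⟨Fin.cons (r u * v) fun i => r (l.get i), fun i => ?_, ?_⟩
        · refine Fin.cases ?_ (fun i => ?_) i
          · simpa using (irreducible_mul_units v).2 (hirr u)
          · simpa using hirr _
        · rw [← hv]
          have h := Fin.prod_univ_succ (Fin.cons (α := fun _ => H) (r u * v)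
            fun i : Fin l.length => r (l.get i))
          refine Eq.trans ?_ h.symm
          simp only [Fin.cons_zero, Fin.cons_succ, List.map_cons, List.prod_cons]
          rw [mul_right_comm]
          exact congrArg _ (Fin.prod_univ_fun_getElem l fun u => r u.1).symm

theorem lengthSet_nonempty (hfg : Monoid.FG (Associates H)) (a : H) :
    (lengthSet H a).Nonempty := by
  obtain ⟨s, hs⟩ := exists_factorizationProd_eq hfg (Associates.mk a)
  exact ⟨s.card, (mem_lengthSet_iff a _).2 ⟨s, rfl, hs⟩⟩

theorem lengthSet_bddAbove (hfg : Monoid.FG (Associates H)) (a : H) :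
    BddAbove (lengthSet H a) := by
  refine (((finite_setOf_factorizationProd_eq hfg (Associates.mk a)).image
    Multiset.card).subset ?_).bddAbove
  intro k hk
  obtain ⟨s, hs, hsa⟩ := (mem_lengthSet_iff a k).1 hk
  exact ⟨s, hsa, hs⟩

theorem sum_mem_lengthSet_prod {ι : Type*} (t : Finset ι) (e : ι → H) (n : ι → ℕ)
    (h : ∀ i ∈ t, n i ∈ lengthSet H (e i)) : ∑ i ∈ t, n i ∈ lengthSet H (∏ i ∈ t, e i) := by
  classical
  induction t using Finset.induction_on with
  | empty => simp [lengthSet]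
  | insert i t hi ih =>
    rw [Finset.sum_insert hi, Finset.prod_insert hi, mem_lengthSet_iff]
    obtain ⟨s, hs, hsa⟩ := (mem_lengthSet_iff _ _).1 (h i (by simp))
    obtain ⟨r, hr, hra⟩ := (mem_lengthSet_iff _ _).1 (ih fun j hj => h j (by simp [hj]))
    exact ⟨s + r, by simp [hs, hr], by rw [factorizationProd_add, hsa, hra, Associates.mk_mul_mk]⟩

/-- If a factorization of `∏ i, e i` of maximal length splits into factorizations of the `e i`,
then these have maximal length too. -/
theorem sSup_lengthSet_prod_eq (hfg : Monoid.FG (Associates H)) {ι : Type*} [Fintype ι]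
    (e : ι → H) (n : ι → ℕ) (h : ∀ i, n i ∈ lengthSet H (e i))
    (hn : ∑ i, n i = sSup (lengthSet H (∏ i, e i))) :
    sSup (lengthSet H (∏ i, e i)) = ∑ i, sSup (lengthSet H (e i)) := by
  apply le_antisymm
  · rw [← hn]
    exact Finset.sum_le_sum fun i _ => le_csSup (lengthSet_bddAbove hfg _) (h i)
  · exact le_csSup (lengthSet_bddAbove hfg _) (sum_mem_lengthSet_prod _ _ _ fun i _ =>
      Nat.sSup_mem (lengthSet_nonempty hfg _) (lengthSet_bddAbove hfg _))

/-- If a factorization of `∏ i, e i` of minimal length splits into factorizations of the `e i`,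
then these have minimal length too. -/
theorem sInf_lengthSet_prod_eq (hfg : Monoid.FG (Associates H)) {ι : Type*} [Fintype ι]
    (e : ι → H) (n : ι → ℕ) (h : ∀ i, n i ∈ lengthSet H (e i))
    (hn : ∑ i, n i = sInf (lengthSet H (∏ i, e i))) :
    sInf (lengthSet H (∏ i, e i)) = ∑ i, sInf (lengthSet H (e i)) := by
  apply le_antisymm
  · exact Nat.sInf_le (sum_mem_lengthSet_prod _ _ _ fun i _ =>
      Nat.sInf_mem (lengthSet_nonempty hfg _))
  · rw [← hn]
    exact Finset.sum_le_sum fun i _ => Nat.sInf_le (h i)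

/-- The quadruples `(z, w, m, l)` for which `z` and `w` are factorizations of `c ^ m * b ^ l`. -/
def factorizationPairs (c b : H) :
    AddSubmonoid (Multiset (ReducedAtom H) × Multiset (ReducedAtom H) × ℕ × ℕ) where
  carrier := {x | factorizationProd (.ofAdd x.1) = Associates.mk (c ^ x.2.2.1 * b ^ x.2.2.2) ∧
    factorizationProd (.ofAdd x.2.1) = Associates.mk (c ^ x.2.2.1 * b ^ x.2.2.2)}
  zero_mem' := by simp [factorizationProd_ofAdd]
  add_mem' := by
    rintro x y ⟨hx, hx'⟩ ⟨hy, hy'⟩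
    simp only [Set.mem_ofPred_eq, Prod.fst_add, Prod.snd_add, factorizationProd_add, hx, hx', hy,
      hy', Associates.mk_mul_mk, pow_add, mul_mul_mul_comm, and_self]

theorem mem_factorizationPairs {c b : H}
    {x : Multiset (ReducedAtom H) × Multiset (ReducedAtom H) × ℕ × ℕ} :
    x ∈ factorizationPairs c b ↔
      factorizationProd (.ofAdd x.1) = Associates.mk (c ^ x.2.2.1 * b ^ x.2.2.2) ∧
      factorizationProd (.ofAdd x.2.1) = Associates.mk (c ^ x.2.2.1 * b ^ x.2.2.2) :=
  Iff.rfl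

theorem factorizationPairs_subtractive (c b : H)
    (x y : Multiset (ReducedAtom H) × Multiset (ReducedAtom H) × ℕ × ℕ)
    (hx : x ∈ factorizationPairs c b) (hxy : x + y ∈ factorizationPairs c b) :
    y ∈ factorizationPairs c b := by
  rw [mem_factorizationPairs] at *
  have hmk : Associates.mk (c ^ (x + y).2.2.1 * b ^ (x + y).2.2.2) =
      Associates.mk (c ^ x.2.2.1 * b ^ x.2.2.2) * Associates.mk (c ^ y.2.2.1 * b ^ y.2.2.2) := by
    simp only [Prod.fst_add, Prod.snd_add, pow_add, Associates.mk_mul_mk, mul_mul_mul_comm]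
  rw [hmk, Prod.fst_add, Prod.snd_add, Prod.fst_add, factorizationProd_add,
    factorizationProd_add, hx.1, hx.2] at hxy
  exact ⟨mul_left_cancel hxy.1, mul_left_cancel hxy.2⟩

end Factorization

/-- Suppose `H_red` is finitely generated, `min R̄(H) < max R̄(H)`,
`c` is a nonunit with `lim ρ(cⁿ) = max R̄(H)` and `b` is an atom with
`lim ρ(bⁿ) = min R̄(H)`. Then there is `M ∈ ℕ` such that for all `k ∈ ℕ` and `ℓ ∈ ℕ₀`
there are `ℓ₁, …, ℓ_k ∈ ℤ` with `ℓ₁ + ⋯ + ℓ_k = ℓ`, elements `hᵢ ∈ H` equal to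
`c^M b^{ℓᵢ}` in the quotient group (i.e. `hᵢ · b^{(ℓᵢ)⁻} = c^M · b^{(ℓᵢ)⁺}`), with
`max L(c^{kM} bˡ) = ∑ max L(c^M b^{ℓᵢ})` and `min L(c^{kM} bˡ) = ∑ min L(c^M b^{ℓᵢ})`. -/
theorem statement11 (H : Type*) [CancelCommMonoid H]
    (hfg : Monoid.FG (Associates H))
    (hlt : sInf (asympSet H) < sSup (asympSet H))
    (c : H) (hc : ¬ IsUnit c)
    (hcmax : Tendsto (fun n : ℕ => ((elasticity H (c ^ n) : ℝ) : EReal)) atTop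
      (nhds (sSup (asympSet H))))
    (b : H) (hb : Irreducible b)
    (hbmin : Tendsto (fun n : ℕ => ((elasticity H (b ^ n) : ℝ) : EReal)) atTop
      (nhds (sInf (asympSet H)))) :
    ∃ M : ℕ, 0 < M ∧ ∀ k : ℕ, 0 < k → ∀ ℓ : ℕ,
      ∃ (L : Fin k → ℤ) (e : Fin k → H),
        (∑ i, L i) = (ℓ : ℤ) ∧
        (∀ i, e i * b ^ (-(L i)).toNat = c ^ M * b ^ (L i).toNat) ∧
        sSup (lengthSet H (c ^ (k * M) * b ^ ℓ)) = ∑ i, sSup (lengthSet H (e i)) ∧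
        sInf (lengthSet H (c ^ (k * M) * b ^ ℓ)) = ∑ i, sInf (lengthSet H (e i)) := by
  have := wellQuasiOrderedLE_multiset_reducedAtom hfg
  obtain ⟨B, hB, hdec⟩ := (factorizationPairs c b).exists_finite_multiset_sum_of_subtractive
    (factorizationPairs_subtractive c b)
  obtain ⟨N₀, hN₀⟩ := (hB.image fun x => x.2.2.1).bddAbove
  set N := N₀ + 1 with hN
  have hBN : ∀ x ∈ B, x.2.2.1 ≤ N := fun x hx => (hN₀ ⟨x, hx, rfl⟩).trans (Nat.le_succ _)
  refine ⟨N * N.factorial, by positivity, fun k hk ℓ => ?_⟩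
  obtain ⟨z, hz, hza⟩ := (mem_lengthSet_iff _ _).1 (Nat.sSup_mem (lengthSet_nonempty hfg
    (c ^ (k * (N * N.factorial)) * b ^ ℓ)) (lengthSet_bddAbove hfg _))
  obtain ⟨w, hw, hwa⟩ := (mem_lengthSet_iff _ _).1 (Nat.sInf_mem (lengthSet_nonempty hfg
    (c ^ (k * (N * N.factorial)) * b ^ ℓ)))
  obtain ⟨s, hs, hsum⟩ := hdec (z, w, k * (N * N.factorial), ℓ) ⟨hza, hwa⟩
  let pr : Multiset (ReducedAtom H) × Multiset (ReducedAtom H) × ℕ × ℕ →+ ℕ :=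
    (AddMonoidHom.fst ℕ ℕ).comp ((AddMonoidHom.snd _ _).comp (AddMonoidHom.snd _ _))
  obtain ⟨g, hg, hgM⟩ := s.exists_sum_eq_of_sum_map_eq_mul pr (Nat.succ_pos N₀) k hk
    (fun x hx => hBN x (hs x hx).1) (by rw [← map_multiset_sum, hsum]; rfl)
  have hgS : ∀ i, (g i).sum ∈ factorizationPairs c b := fun i =>
    AddSubmonoid.multiset_sum_mem _ _ fun x hx => (hs x (by
      rw [← hg]; exact Multiset.mem_sum.2 ⟨i, Finset.mem_univ i, hx⟩)).2
  have hgM' : ∀ i, (g i).sum.2.2.1 = N * N.factorial := fun i => by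
    rw [← hgM i, ← map_multiset_sum]; rfl
  have hgsum : ∑ i, (g i).sum = (z, w, k * (N * N.factorial), ℓ) := by
    rw [← hsum, ← hg]
    exact (map_sum Multiset.sumAddMonoidHom g Finset.univ).symm
  have h1 : ∑ i, (g i).sum.1 = z := by
    simpa [Prod.fst_sum] using congrArg Prod.fst hgsum
  have h2 : ∑ i, (g i).sum.2.1 = w := by
    simpa [Prod.fst_sum, Prod.snd_sum] using congrArg (fun x => x.2.1) hgsum
  have h4 : ∑ i, (g i).sum.2.2.2 = ℓ := by
    simpa [Prod.fst_sum, Prod.snd_sum] using congrArg (fun x => x.2.2.2) hgsum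
  have hprod : c ^ (k * (N * N.factorial)) * b ^ ℓ =
      ∏ i, c ^ (N * N.factorial) * b ^ (g i).sum.2.2.2 := by
    rw [Finset.prod_mul_distrib, Finset.prod_pow_eq_pow_sum _ _ b, h4, Finset.prod_const,
      Finset.card_univ, Fintype.card_fin, ← pow_mul, mul_comm k]
  simp only [mem_factorizationPairs, hgM'] at hgS
  refine ⟨fun i => (g i).sum.2.2.2, fun i => c ^ (N * N.factorial) * b ^ (g i).sum.2.2.2,
    by beta_reduce; exact_mod_cast h4, fun i => by simp, ?_, ?_⟩
  · rw [hprod] at hz ⊢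
    refine sSup_lengthSet_prod_eq hfg _ (fun i => (g i).sum.1.card)
      (fun i => (mem_lengthSet_iff _ _).2 ⟨_, rfl, (hgS i).1⟩) ?_
    rw [← hz, ← h1, Multiset.card_sum]
  · rw [hprod] at hw ⊢
    refine sInf_lengthSet_prod_eq hfg _ (fun i => (g i).sum.2.1.card)
      (fun i => (mem_lengthSet_iff _ _).2 ⟨_, rfl, (hgS i).2⟩) ?_
    rw [← hw, ← h2, Multiset.card_sum]
end

section
/- Let H be a monoid such that the reduced quotient H_red = H/H^× is finitely generated and H ≠ H^×. Then R̄(H) = {q ∈ ℚ : inf R̄(H) ≤ q ≤ sup R̄(H)}, i.e., the set of asymptotic elasticities of H is exactly the set of rational numbers in the closed interval [inf R̄(H), sup R̄(H)] (where sup R̄(H) = ρ(H)). -/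
open Filter Topology

/-- In a canonically ordered, well-quasi-ordered monoid, the ratio `f / g` of two additive functions attains its
maximum on a subtractive submonoid. -/
theorem exists_max_ratio {X : Type*} [AddCommMonoid X] [PartialOrder X] [WellQuasiOrderedLE X]
    [IsOrderedCancelAddMonoid X] [CanonicallyOrderedAdd X] (P : AddSubmonoid X)
    (hP : ∀ x ∈ P, ∀ y, x + y ∈ P → y ∈ P) (f g : X →+ ℕ)
    (hg : ∀ x ∈ P, g x = 0 → x = 0) (hne : ∃ x ∈ P, x ≠ 0) :
    ∃ x₀ ∈ P, 0 < g x₀ ∧ ∀ x ∈ P, f x * g x₀ ≤ f x₀ * g x := by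
  classical
  obtain ⟨T, hT⟩ := AddSubmonoid.fg_of_subtractive hP
  have hTP : ∀ x ∈ T, x ∈ P := fun x hx => hT ▸ AddSubmonoid.subset_closure hx
  have hne' : (T.filter (· ≠ 0)).Nonempty := by
    by_contra hcon
    rw [Finset.not_nonempty_iff_eq_empty, Finset.filter_eq_empty_iff] at hcon
    push Not at hcon
    obtain ⟨x, hx, hx0⟩ := hne
    apply hx0
    have : P ≤ ⊥ := by
      rw [← hT, AddSubmonoid.closure_le]
      intro y hy
      simpa using hcon hy
    simpa using this hx
  obtain ⟨x₀, hx₀, hmax⟩ := Finset.exists_max_image _ (fun x => (f x : ℚ) / g x) hne'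
  rw [Finset.mem_filter] at hx₀
  have hpos : ∀ x ∈ P, x ≠ 0 → 0 < g x := fun x hx h =>
    Nat.pos_of_ne_zero fun h0 => h (hg x hx h0)
  refine ⟨x₀, hTP _ hx₀.1, hpos _ (hTP _ hx₀.1) hx₀.2, fun x hx => ?_⟩
  rw [← hT] at hx
  induction hx using AddSubmonoid.closure_induction with
  | mem x hx =>
    by_cases h : x = 0
    · simp [h]
    have h1 := hmax x (by simpa [h] using hx)
    have h2 : (0 : ℚ) < g x := by exact_mod_cast hpos x (hTP x hx) h
    have h3 : (0 : ℚ) < g x₀ := by exact_mod_cast hpos x₀ (hTP x₀ hx₀.1) hx₀.2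
    rw [div_le_div_iff₀ h2 h3] at h1
    exact_mod_cast h1
  | zero => simp
  | add x y _ _ hx hy =>
    rw [map_add, map_add, add_mul, mul_add]
    exact add_le_add hx hy

/-- A parametrization of the factorizations in `H` (up to associates) by a well-quasi-ordered
monoid `X`, together with the length function. -/
structure LengthModel (H X : Type*) [CancelCommMonoid H] [AddCommMonoid X] where
  /-- The product of a factorization. -/
  val : X → Associates H
  /-- The length of a factorization. -/
  len : X →+ ℕ
  val_zero : val 0 = 1
  val_add : ∀ x y, val (x + y) = val x * val y
  val_surjective : Function.Surjective val
  eq_zero_of_val : ∀ x, val x = 1 → x = 0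
  eq_zero_of_len : ∀ x, len x = 0 → x = 0
  mem_lengthSet : ∀ (a : H) (k : ℕ), k ∈ lengthSet H a ↔ ∃ x, val x = Associates.mk a ∧ len x = k

theorem Associates.mul_left_cancel_of_cancelCommMonoid {H : Type*} [CancelCommMonoid H]
    {a b c : Associates H} (h : a * b = a * c) : b = c := by
  induction a using Quotient.inductionOn
  induction b using Quotient.inductionOn
  induction c using Quotient.inductionOn
  rename_i a b c
  obtain ⟨u, hu⟩ := Associates.mk_eq_mk_iff_associated.1 (show Associates.mk (a * b) =
    Associates.mk (a * c) from h)
  refine Associates.mk_eq_mk_iff_associated.2 ⟨u, ?_⟩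
  rw [mul_assoc] at hu
  exact mul_left_cancel hu

/-- All positive powers of the nonunit `c` have elasticity `r`. -/
def HasConstElasticity (H : Type*) [CommMonoid H] (c : H) (r : ℝ) : Prop :=
  ¬ IsUnit c ∧ ∀ n : ℕ, 0 < n → elasticity H (c ^ n) = r

namespace LengthModel

variable {H X : Type*} [CancelCommMonoid H] [AddCommMonoid X]

theorem val_nsmul (m : LengthModel H X) (n : ℕ) (x : X) : m.val (n • x) = m.val x ^ n := by
  induction n with
  | zero => simp [m.val_zero]
  | succ n ih => rw [succ_nsmul, m.val_add, ih, pow_succ]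

theorem val_sub (m : LengthModel H X) {x y x' y' : X} (h : m.val x = m.val y)
    (h' : m.val (x + x') = m.val (y + y')) : m.val x' = m.val y' := by
  rw [m.val_add, m.val_add, h] at h'
  exact Associates.mul_left_cancel_of_cancelCommMonoid h'

theorem len_pos (m : LengthModel H X) {a : H} (ha : ¬ IsUnit a) {y : X}
    (hy : m.val y = Associates.mk a) : 0 < m.len y := by
  refine Nat.pos_of_ne_zero fun h => ha ?_
  rw [m.eq_zero_of_len y h, m.val_zero] at hy
  exact Associates.mk_eq_one.1 hy.symm

theorem lengthSet_nonempty (m : LengthModel H X) (a : H) : (lengthSet H a).Nonempty := by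
  obtain ⟨x, hx⟩ := m.val_surjective (Associates.mk a)
  exact ⟨m.len x, (m.mem_lengthSet _ _).2 ⟨x, hx, rfl⟩⟩

variable [PartialOrder X] [WellQuasiOrderedLE X] [CanonicallyOrderedAdd X]

theorem lengthSet_finite (m : LengthModel H X) (a : H) : (lengthSet H a).Finite := by
  have h : {x | m.val x = Associates.mk a}.Finite := by
    apply WellQuasiOrderedLE.finite_of_isAntichain
    intro x hx y hy hxy hle
    obtain ⟨z, rfl⟩ := exists_add_of_le hle
    have h1 : m.val z = m.val 0 := m.val_sub (x := x) rfl (by rw [add_zero]; exact hy.trans hx.symm)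
    rw [m.eq_zero_of_val z (h1.trans m.val_zero), add_zero] at hxy
    exact hxy rfl
  refine (h.image m.len).subset fun k hk => ?_
  exact (m.mem_lengthSet a k).1 hk

theorem exists_elasticity_eq (m : LengthModel H X) {a : H} (ha : ¬ IsUnit a) :
    ∃ x y, m.val x = Associates.mk a ∧ m.val y = Associates.mk a ∧
      elasticity H a = (m.len x : ℝ) / m.len y := by
  obtain ⟨x, hx, hx'⟩ := (m.mem_lengthSet a _).1
    (Nat.sSup_mem (m.lengthSet_nonempty a) (m.lengthSet_finite a).bddAbove)
  obtain ⟨y, hy, hy'⟩ := (m.mem_lengthSet a _).1 (Nat.sInf_mem (m.lengthSet_nonempty a))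
  exact ⟨x, y, hx, hy, by rw [elasticity, if_neg ha, hx', hy']⟩

theorem le_elasticity (m : LengthModel H X) {a : H} (ha : ¬ IsUnit a) {x y : X}
    (hx : m.val x = Associates.mk a) (hy : m.val y = Associates.mk a) :
    (m.len x : ℝ) / m.len y ≤ elasticity H a := by
  have hx' : m.len x ≤ sSup (lengthSet H a) :=
    le_csSup (m.lengthSet_finite a).bddAbove ((m.mem_lengthSet _ _).2 ⟨x, hx, rfl⟩)
  have hy' : sInf (lengthSet H a) ≤ m.len y :=
    Nat.sInf_le ((m.mem_lengthSet _ _).2 ⟨y, hy, rfl⟩)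
  have hpos : 0 < sInf (lengthSet H a) := by
    obtain ⟨z, hz, hz'⟩ := (m.mem_lengthSet a _).1 (Nat.sInf_mem (m.lengthSet_nonempty a))
    rw [← hz']
    exact m.len_pos ha hz
  rw [elasticity, if_neg ha]
  gcongr

theorem _root_.elasticity_nonneg {H : Type*} [CommMonoid H] (a : H) : 0 ≤ elasticity H a := by
  unfold elasticity
  split_ifs <;> positivity

theorem hasConstElasticity (m : LengthModel H X) {c : H} (hc : ¬ IsUnit c) {x y : X}
    (hx : m.val x = Associates.mk c) (hy : m.val y = Associates.mk c)
    (hmax : ∀ n x' y', 0 < n → m.val x' = Associates.mk (c ^ n) →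
      m.val y' = Associates.mk (c ^ n) → m.len x' * m.len y ≤ m.len x * m.len y') :
    HasConstElasticity H c ((m.len x : ℝ) / m.len y) := by
  refine ⟨hc, fun n hn => ?_⟩
  have hcn : ¬ IsUnit (c ^ n) := by rwa [isUnit_pow_iff hn.ne']
  have hypos : (0 : ℝ) < m.len y := by exact_mod_cast m.len_pos hc hy
  apply le_antisymm
  · obtain ⟨x', y', hx', hy', h⟩ := m.exists_elasticity_eq hcn
    have hy'pos : (0 : ℝ) < m.len y' := by exact_mod_cast m.len_pos hcn hy'
    rw [h, div_le_div_iff₀ hy'pos hypos]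
    exact_mod_cast hmax n x' y' hn hx' hy'
  · have h := m.le_elasticity hcn (x := n • x) (y := n • y)
      (by rw [m.val_nsmul, hx, Associates.mk_pow]) (by rw [m.val_nsmul, hy, Associates.mk_pow])
    have hn' : (n : ℝ) ≠ 0 := by exact_mod_cast hn.ne'
    rwa [map_nsmul, map_nsmul, smul_eq_mul, smul_eq_mul, Nat.cast_mul, Nat.cast_mul,
      mul_div_mul_left _ _ hn'] at h

/-- If every element of a generating set has a power with elasticity at least `r`, then
so does every element of the monoid. -/
theorem le_of_hasConstElasticity (m : LengthModel H X) {S : Set (Associates H)}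
    (hS : Submonoid.closure S = ⊤) {r : ℝ}
    (hr : ∀ u ∈ S, ∃ (k : ℕ) (x y : X), 0 < k ∧ m.val x = u ^ k ∧ m.val y = u ^ k ∧
      r * m.len y ≤ m.len x) {c : H} {q : ℝ} (hc : HasConstElasticity H c q) : r ≤ q := by
  have key : ∀ u : Associates H, ∃ (k : ℕ) (x y : X), 0 < k ∧ m.val x = u ^ k ∧
      m.val y = u ^ k ∧ r * m.len y ≤ m.len x := by
    intro u
    have hu : u ∈ Submonoid.closure S := hS ▸ Submonoid.mem_top u
    induction hu using Submonoid.closure_induction with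
    | mem u hu => exact hr u hu
    | one => exact ⟨1, 0, 0, one_pos, by simp [m.val_zero], by simp [m.val_zero], by simp⟩
    | mul u v _ _ hu hv =>
      obtain ⟨k, x, y, hk, hx, hy, h⟩ := hu
      obtain ⟨k', x', y', hk', hx', hy', h'⟩ := hv
      refine ⟨k * k', k' • x + k • x', k' • y + k • y', Nat.mul_pos hk hk', ?_, ?_, ?_⟩
      · rw [m.val_add, m.val_nsmul, m.val_nsmul, hx, hx', mul_pow, pow_mul, mul_comm k k', pow_mul]
      · rw [m.val_add, m.val_nsmul, m.val_nsmul, hy, hy', mul_pow, pow_mul, mul_comm k k', pow_mul]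
      · simp only [map_add, map_nsmul, smul_eq_mul, Nat.cast_add, Nat.cast_mul]
        have h1 := mul_le_mul_of_nonneg_left h (Nat.cast_nonneg (α := ℝ) k')
        have h2 := mul_le_mul_of_nonneg_left h' (Nat.cast_nonneg (α := ℝ) k)
        linarith
  obtain ⟨k, x, y, hk, hx, hy, h⟩ := key (Associates.mk c)
  rw [← Associates.mk_pow] at hx hy
  have hck : ¬ IsUnit (c ^ k) := by rw [isUnit_pow_iff hk.ne']; exact hc.1
  have hypos : (0 : ℝ) < m.len y := by exact_mod_cast m.len_pos hck hy
  rw [← hc.2 k hk]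
  exact ((le_div_iff₀ hypos).2 h).trans (m.le_elasticity hck hx hy)

variable [IsOrderedCancelAddMonoid X]

/-- Some power of each nonunit has constant elasticity. -/
theorem exists_pow_hasConstElasticity (m : LengthModel H X) {a : H} (ha : ¬ IsUnit a) :
    ∃ (k : ℕ) (x y : X), 0 < k ∧ m.val x = Associates.mk (a ^ k) ∧
      m.val y = Associates.mk (a ^ k) ∧
      HasConstElasticity H (a ^ k) ((m.len x : ℝ) / m.len y) := by
  let P : AddSubmonoid (ℕ × X × X) :=
    { carrier := {p | m.val p.2.1 = Associates.mk (a ^ p.1) ∧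
        m.val p.2.2 = Associates.mk (a ^ p.1)}
      zero_mem' := by simp [m.val_zero]
      add_mem' := by
        rintro ⟨k, x, y⟩ ⟨k', x', y'⟩ ⟨h1, h2⟩ ⟨h1', h2'⟩
        dsimp only at h1 h2 h1' h2'
        constructor <;> simp [m.val_add, *, pow_add, ← Associates.mk_mul_mk] }
  have hsub : ∀ p ∈ P, ∀ q, p + q ∈ P → q ∈ P := by
    rintro ⟨k, x, y⟩ ⟨h1, h2⟩ ⟨k', x', y'⟩ ⟨h1', h2'⟩
    dsimp only [Prod.mk_add_mk] at h1 h2 h1' h2'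
    rw [m.val_add, pow_add, ← Associates.mk_mul_mk] at h1' h2'
    rw [h1] at h1'
    rw [h2] at h2'
    exact ⟨Associates.mul_left_cancel_of_cancelCommMonoid h1',
      Associates.mul_left_cancel_of_cancelCommMonoid h2'⟩
  obtain ⟨x₁, hx₁⟩ := m.val_surjective (Associates.mk a)
  obtain ⟨⟨k, x, y⟩, ⟨hx, hy⟩, hpos, hmax⟩ := exists_max_ratio P hsub
    (m.len.comp ((AddMonoidHom.fst X X).comp (AddMonoidHom.snd ℕ (X × X))))
    (m.len.comp ((AddMonoidHom.snd X X).comp (AddMonoidHom.snd ℕ (X × X))))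
    (by
      rintro ⟨k, x, y⟩ ⟨h1, h2⟩ h0
      dsimp only at h1 h2
      have hy : y = 0 := m.eq_zero_of_len _ h0
      rw [hy, m.val_zero] at h2
      have hx : x = 0 := m.eq_zero_of_val _ (h1.trans h2.symm)
      have hk : k = 0 := by
        by_contra hk
        exact ha ((isUnit_pow_iff hk).1 (Associates.mk_eq_one.1 h2.symm))
      rw [hx, hy, hk]; rfl)
    ⟨(1, x₁, x₁), ⟨by simpa using hx₁, by simpa using hx₁⟩, by simp⟩
  dsimp only at hx hy
  simp only [AddMonoidHom.coe_comp, AddMonoidHom.coe_fst, AddMonoidHom.coe_snd,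
    Function.comp_apply] at hpos hmax
  have hk : 0 < k := by
    refine Nat.pos_of_ne_zero fun hk => ?_
    rw [hk, pow_zero, Associates.mk_one] at hy
    rw [m.eq_zero_of_val _ hy, map_zero] at hpos
    exact lt_irrefl _ hpos
  refine ⟨k, x, y, hk, hx, hy, m.hasConstElasticity (by rwa [isUnit_pow_iff hk.ne']) hx hy ?_⟩
  intro n x' y' hn hx' hy'
  exact hmax (k * n, x', y') ⟨by simpa [pow_mul] using hx', by simpa [pow_mul] using hy'⟩

theorem mem_asympSet_iff (m : LengthModel H X) (r : EReal) :
    r ∈ asympSet H ↔ ∃ (c : H) (q : ℚ), HasConstElasticity H c q ∧ r = ((q : ℝ) : EReal) := by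
  constructor
  · rintro ⟨a, ha, hlim⟩
    obtain ⟨k, x, y, hk, -, -, hc⟩ := m.exists_pow_hasConstElasticity ha
    refine ⟨a ^ k, (m.len x : ℚ) / m.len y, by simpa using hc, ?_⟩
    have hsub : Tendsto (fun n : ℕ => k * (n + 1)) atTop atTop :=
      (tendsto_add_atTop_nat 1).const_mul_atTop' hk
    have h := hlim.comp hsub
    refine tendsto_nhds_unique h ?_
    refine tendsto_const_nhds.congr fun n => ?_
    rw [Function.comp_apply, pow_mul, hc.2 _ n.succ_pos]
    simp
  · rintro ⟨c, q, hc, rfl⟩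
    refine ⟨c, hc.1, tendsto_const_nhds.congr' ?_⟩
    filter_upwards [eventually_gt_atTop 0] with n hn
    rw [hc.2 n hn]

/-- The elasticity of the monoid is attained by an element of constant elasticity. -/
theorem exists_hasConstElasticity_max (m : LengthModel H X) (hne : ∃ a : H, ¬ IsUnit a) :
    ∃ (c : H) (q : ℚ), HasConstElasticity H c q ∧ ∀ a : H, elasticity H a ≤ q := by
  let P : AddSubmonoid (X × X) :=
    { carrier := {p | m.val p.1 = m.val p.2}
      zero_mem' := rfl
      add_mem' := by
        rintro ⟨x, y⟩ ⟨x', y'⟩ (h : m.val x = m.val y) (h' : m.val x' = m.val y')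
        show m.val (x + x') = m.val (y + y')
        rw [m.val_add, m.val_add, h, h'] }
  have hsub : ∀ p ∈ P, ∀ q, p + q ∈ P → q ∈ P := fun p hp q hq => m.val_sub hp hq
  obtain ⟨a, ha⟩ := hne
  obtain ⟨x₁, hx₁⟩ := m.val_surjective (Associates.mk a)
  obtain ⟨⟨x, y⟩, hxy, hpos, hmax⟩ := exists_max_ratio P hsub
    (m.len.comp (AddMonoidHom.fst X X)) (m.len.comp (AddMonoidHom.snd X X))
    (by
      rintro ⟨x, y⟩ (h : m.val x = m.val y) h0
      have hy : y = 0 := m.eq_zero_of_len _ h0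
      rw [hy, m.val_zero] at h
      rw [m.eq_zero_of_val _ h, hy]; rfl)
    ⟨(x₁, x₁), rfl, fun h => by
      have h1 := m.len_pos ha hx₁
      rw [(Prod.mk_eq_zero.1 h).1, map_zero] at h1
      exact lt_irrefl _ h1⟩
  replace hxy : m.val x = m.val y := hxy
  replace hpos : 0 < m.len y := hpos
  replace hmax : ∀ x' y', m.val x' = m.val y' → m.len x' * m.len y ≤ m.len x * m.len y' :=
    fun x' y' h => hmax (x', y') h
  obtain ⟨c, hc⟩ := Associates.mk_surjective (m.val y)
  have hcu : ¬ IsUnit c := fun h => by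
    rw [Associates.mk_eq_one.2 h] at hc
    rw [m.eq_zero_of_val _ hc.symm, map_zero] at hpos
    exact lt_irrefl _ hpos
  have hypos : (0 : ℝ) < m.len y := by exact_mod_cast hpos
  refine ⟨c, (m.len x : ℚ) / m.len y, ?_, fun b => ?_⟩
  · simpa using m.hasConstElasticity hcu (hxy.trans hc.symm) hc.symm
      fun n x' y' _ hx' hy' => hmax x' y' (hx'.trans hy'.symm)
  · push_cast
    by_cases hb : IsUnit b
    · rw [elasticity, if_pos hb, one_le_div hypos]
      have h := hmax x₁ x₁ rfl
      rw [mul_comm] at h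
      exact_mod_cast Nat.le_of_mul_le_mul_right h (m.len_pos ha hx₁)
    · obtain ⟨x', y', hx', hy', h⟩ := m.exists_elasticity_eq hb
      have hy'pos : (0 : ℝ) < m.len y' := by exact_mod_cast m.len_pos hb hy'
      rw [h, div_le_div_iff₀ hy'pos hypos]
      exact_mod_cast hmax x' y' (hx'.trans hy'.symm)

/-- Constant elasticities satisfy the intermediate value property over the rationals. -/
theorem exists_hasConstElasticity_between (m : LengthModel H X) {a b : H} {r₀ r₁ : ℝ} {q : ℚ}
    (ha : HasConstElasticity H a r₀) (hb : HasConstElasticity H b r₁) (h₀ : r₀ < q)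
    (h₁ : q < r₁) : ∃ c : H, HasConstElasticity H c q := by
  obtain ⟨A, B, hB, hq⟩ : ∃ A B : ℕ, 0 < B ∧ (q : ℝ) = A / B := by
    have hr : (0 : ℝ) ≤ r₀ := by
      rw [← ha.2 1 one_pos]
      exact elasticity_nonneg _
    have hq0 : (0 : ℚ) ≤ q := by exact_mod_cast (hr.trans h₀.le)
    refine ⟨q.num.toNat, q.den, q.den_pos, ?_⟩
    have h1 : ((q.num.toNat : ℤ) : ℝ) = q.num := by
      rw [Int.toNat_of_nonneg (Rat.num_nonneg.2 hq0)]
    rw [Int.cast_natCast] at h1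
    rw [h1]
    exact Rat.cast_def q
  have hB' : (0 : ℝ) < B := by exact_mod_cast hB
  have habu : ∀ k l : ℕ, IsUnit (a ^ k * b ^ l) → k = 0 ∧ l = 0 := by
    intro k l h
    rw [IsUnit.mul_iff] at h
    exact ⟨by_contra fun hk => ha.1 ((isUnit_pow_iff hk).1 h.1),
      by_contra fun hl => hb.1 ((isUnit_pow_iff hl).1 h.2)⟩
  let w : ℕ × ℕ → Associates H := fun k => Associates.mk (a ^ k.1 * b ^ k.2)
  have hw_add : ∀ k l, w (k + l) = w k * w l := by
    intro k l
    simp only [w, Associates.mk_mul_mk, Prod.fst_add, Prod.snd_add, pow_add]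
    congr 1
    exact mul_mul_mul_comm _ _ _ _
  have hw_one : ∀ k, w k = 1 → k = 0 := by
    intro k hk
    obtain ⟨h1, h2⟩ := habu _ _ (Associates.mk_eq_one.1 hk)
    exact Prod.ext h1 h2
  have hw_zero : w 0 = 1 := by simp [w]
  have hw_nsmul : ∀ (n : ℕ) k, w (n • k) = w k ^ n := by
    intro n k
    simp only [w, Prod.smul_fst, Prod.smul_snd, smul_eq_mul, ← Associates.mk_pow, mul_pow,
      ← pow_mul, mul_comm n]
  let P : AddSubmonoid ((ℕ × ℕ) × (X × X) × ℕ) :=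
    { carrier := {p | m.val p.2.1.1 = w p.1 ∧ m.val p.2.1.2 = w p.1 ∧
        B * m.len p.2.1.1 = A * m.len p.2.1.2 + p.2.2}
      zero_mem' := by simp [m.val_zero, hw_zero]
      add_mem' := by
        rintro ⟨k, ⟨x, y⟩, s⟩ ⟨k', ⟨x', y'⟩, s'⟩ ⟨h1, h2, h3⟩ ⟨h1', h2', h3'⟩
        dsimp only at h1 h2 h1' h2' h3 h3'
        refine ⟨?_, ?_, ?_⟩
        · simp [m.val_add, hw_add, h1, h1']
        · simp [m.val_add, hw_add, h2, h2']
        · simp only [Prod.mk_add_mk, map_add]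
          linarith }
  have hsub : ∀ p ∈ P, ∀ q, p + q ∈ P → q ∈ P := by
    rintro ⟨k, ⟨x, y⟩, s⟩ ⟨h1, h2, h3⟩ ⟨k', ⟨x', y'⟩, s'⟩ ⟨h1', h2', h3'⟩
    dsimp only [Prod.mk_add_mk] at h1 h2 h1' h2' h3 h3'
    rw [m.val_add, hw_add] at h1' h2'
    rw [h1] at h1'
    rw [h2] at h2'
    refine ⟨Associates.mul_left_cancel_of_cancelCommMonoid h1',
      Associates.mul_left_cancel_of_cancelCommMonoid h2', ?_⟩
    rw [map_add, map_add] at h3'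
    dsimp only
    linarith
  have hpos_of_ne : ∀ {k y}, m.val y = w k → k ≠ 0 → 0 < m.len y := by
    intro k y hy hk
    refine Nat.pos_of_ne_zero fun h => hk (hw_one k ?_)
    rw [← hy, m.eq_zero_of_len _ h, m.val_zero]
  let fstK := (AddMonoidHom.fst ℕ ℕ).comp (AddMonoidHom.fst (ℕ × ℕ) ((X × X) × ℕ))
  let sndK := (AddMonoidHom.snd ℕ ℕ).comp (AddMonoidHom.fst (ℕ × ℕ) ((X × X) × ℕ))
  obtain ⟨⟨k, ⟨x, y⟩, s⟩, hmem, hpos, hmax⟩ := exists_max_ratio P hsub fstK (fstK + sndK)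
    (by
      rintro ⟨⟨k, l⟩, ⟨x, y⟩, s⟩ ⟨h1, h2, h3⟩ (h0 : k + l = 0)
      dsimp only at h1 h2 h3
      obtain ⟨rfl, rfl⟩ := Nat.add_eq_zero_iff.1 h0
      have hx := m.eq_zero_of_val x (h1.trans hw_zero)
      have hy := m.eq_zero_of_val y (h2.trans hw_zero)
      subst hx hy
      have hs : s = 0 := by simpa using h3.symm
      rw [hs]; rfl)
    (by
      obtain ⟨x, y, hx, hy, h⟩ := m.exists_elasticity_eq hb.1
      have hypos : (0 : ℝ) < m.len y := by exact_mod_cast m.len_pos hb.1 hy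
      have hb1 := hb.2 1 one_pos
      rw [pow_one, h] at hb1
      rw [← hb1, hq, div_lt_div_iff₀ hB' hypos] at h₁
      have h2 : A * m.len y < m.len x * B := by exact_mod_cast h₁
      rw [mul_comm _ B] at h2
      obtain ⟨s, hs⟩ := Nat.exists_eq_add_of_le h2.le
      refine ⟨((0, 1), (x, y), s), ⟨?_, ?_, hs⟩, by simp⟩
      · simpa [w] using hx
      · simpa [w] using hy)
  obtain ⟨h1, h2, h3⟩ := hmem
  dsimp only at h1 h2 h3
  replace hpos : 0 < k.1 + k.2 := hpos
  have hk : k ≠ 0 := by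
    rintro rfl
    simp at hpos
  replace hmax : ∀ l x' y', m.val x' = w l → m.val y' = w l →
      A * m.len y' ≤ B * m.len x' → l.1 * (k.1 + k.2) ≤ k.1 * (l.1 + l.2) := by
    intro l x' y' hx' hy' h
    obtain ⟨s', hs'⟩ := Nat.exists_eq_add_of_le h
    exact hmax (l, (x', y'), s') ⟨hx', hy', hs'⟩
  have hk2 : 0 < k.2 := by
    refine Nat.pos_of_ne_zero fun hk2 => ?_
    have hk1 : 0 < k.1 := by omega
    have hau : ¬ IsUnit (a ^ k.1) := by rw [isUnit_pow_iff hk1.ne']; exact ha.1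
    have hx : m.val x = Associates.mk (a ^ k.1) := by simpa [w, hk2] using h1
    have hy : m.val y = Associates.mk (a ^ k.1) := by simpa [w, hk2] using h2
    have hle := m.le_elasticity hau hx hy
    rw [ha.2 _ hk1] at hle
    have hypos : (0 : ℝ) < m.len y := by exact_mod_cast m.len_pos hau hy
    have hlt := hle.trans_lt h₀
    rw [hq, div_lt_div_iff₀ hypos hB'] at hlt
    have h4 : m.len x * B < A * m.len y := by exact_mod_cast hlt
    rw [mul_comm _ B] at h4
    omega
  have hle : ∀ n x' y', 0 < n → m.val x' = w (n • k) → m.val y' = w (n • k) →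
      B * m.len x' ≤ A * m.len y' := by
    intro n x' y' hn hx' hy'
    by_contra! hlt
    obtain ⟨z, hz⟩ := m.val_surjective (w (1, 0))
    set t := A * m.len z + 1 with ht
    have h4 := hmax (t • (n • k) + (1, 0)) (t • x' + z) (t • y' + z)
      (by rw [m.val_add, hw_add, m.val_nsmul, hx', hz, hw_nsmul t])
      (by rw [m.val_add, hw_add, m.val_nsmul, hy', hz, hw_nsmul t])
      (by
        simp only [map_add, map_nsmul, smul_eq_mul]
        nlinarith [Nat.mul_le_mul_left t (Nat.succ_le_of_lt hlt), Nat.zero_le (B * m.len z)])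
    simp only [Prod.fst_add, Prod.snd_add, Prod.smul_fst, Prod.smul_snd, smul_eq_mul] at h4
    nlinarith
  have hs : B * m.len x = A * m.len y :=
    le_antisymm (by simpa using hle 1 x y one_pos (by simpa using h1) (by simpa using h2))
      (by omega)
  have hypos : 0 < m.len y := hpos_of_ne h2 hk
  have hcu : ¬ IsUnit (a ^ k.1 * b ^ k.2) := fun h => by
    have := habu _ _ h
    omega
  refine ⟨a ^ k.1 * b ^ k.2, ?_⟩
  have hfin := m.hasConstElasticity hcu h1 h2 (fun n x' y' hn hx' hy' => by
    have h5 := hle n x' y' hn (by rw [hw_nsmul, hx', Associates.mk_pow])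
      (by rw [hw_nsmul, hy', Associates.mk_pow])
    refine le_of_mul_le_mul_left (a := B) ?_ hB
    calc B * (m.len x' * m.len y) = (B * m.len x') * m.len y := by ring
      _ ≤ (A * m.len y') * m.len y := Nat.mul_le_mul_right _ h5
      _ = (B * m.len x) * m.len y' := by rw [hs]; ring
      _ = _ := by ring)
  convert hfin using 1
  have hypos' : (0 : ℝ) < m.len y := by exact_mod_cast hypos
  rw [hq, div_eq_div_iff hB'.ne' hypos'.ne', mul_comm (m.len x : ℝ)]
  exact_mod_cast hs.symm

end LengthModel

theorem Associates.irreducible_mk_of_commMonoid {H : Type*} [CommMonoid H] {a : H} :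
    Irreducible (Associates.mk a) ↔ Irreducible a := by
  simp only [irreducible_iff, Associates.isUnit_mk, Associates.forall_associated,
    Associates.mk_mul_mk, Associates.mk_eq_mk_iff_associated]
  refine and_congr_right fun _ => ⟨fun h b c hbc => h b c (hbc ▸ Associated.refl _), ?_⟩
  rintro h b c ⟨u, hu⟩
  have h1 := h (a := b * ↑u⁻¹) (b := c) (by
    rw [mul_right_comm, ← hu, mul_assoc, Units.mul_inv, mul_one])
  simpa using h1

theorem mem_lengthSet_iff_s12 {H : Type*} [CommMonoid H] (a : H) (k : ℕ) :
    k ∈ lengthSet H a ↔ ∃ s : Multiset (Associates H), (∀ u ∈ s, Irreducible u) ∧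
      s.prod = Associates.mk a ∧ Multiset.card s = k := by
  have lift : ∀ s : Multiset (Associates H), (∀ u ∈ s, Irreducible u) →
      s.prod = Associates.mk a → ∃ t : Multiset H, (∀ u ∈ t, Irreducible u) ∧
      Associated t.prod a ∧ Multiset.card s = Multiset.card t := by
    intro s hs hprod
    obtain ⟨t, rfl⟩ := Multiset.map_surjective_of_surjective Associates.mk_surjective s
    refine ⟨t, fun u hu => Associates.irreducible_mk_of_commMonoid.1
      (hs _ (Multiset.mem_map_of_mem _ hu)), ?_, by simp⟩
    rw [Associates.prod_mk] at hprod
    exact Associates.mk_eq_mk_iff_associated.1 hprod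
  unfold lengthSet
  split_ifs with ha
  · rw [Set.mem_singleton_iff]
    constructor
    · rintro rfl
      exact ⟨0, by simp, by simpa using (Associates.mk_eq_one.2 ha).symm, rfl⟩
    · rintro ⟨s, hs, hprod, rfl⟩
      obtain ⟨t, ht, hta, hcard⟩ := lift s hs hprod
      rw [hcard, Multiset.card_eq_zero]
      refine Multiset.eq_zero_of_forall_notMem fun u hu => (ht u hu).not_isUnit ?_
      exact isUnit_of_dvd_unit (Multiset.dvd_prod hu) (hta.symm.isUnit ha)
  · constructor
    · rintro ⟨f, hf, rfl⟩
      refine ⟨Finset.univ.val.map fun i => Associates.mk (f i), ?_, ?_, by simp⟩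
      · intro u hu
        obtain ⟨i, -, rfl⟩ := Multiset.mem_map.1 hu
        exact Associates.irreducible_mk_of_commMonoid.2 (hf i)
      · rw [← Finset.prod_eq_multiset_prod, Associates.finsetProd_mk]
    · rintro ⟨s, hs, hprod, rfl⟩
      obtain ⟨t, ht, ⟨v, hv⟩, hcard⟩ := lift s hs hprod
      obtain ⟨c, t', rfl⟩ : ∃ c t', t = c ::ₘ t' := by
        have ht0 : t ≠ 0 := by
          rintro rfl
          exact ha (by rw [← hv]; simp)
        obtain ⟨c, hc⟩ := Multiset.exists_mem_of_ne_zero ht0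
        exact ⟨c, Multiset.exists_cons_of_mem hc⟩
      let l := ((c * v) ::ₘ t').toList
      have hl : (l : Multiset H) = (c * v) ::ₘ t' := Multiset.coe_toList _
      have hlen : l.length = Multiset.card s := by
        rw [hcard, ← Multiset.coe_card, hl]
        simp
      rw [← hlen]
      refine ⟨l.get, fun i => ?_, ?_⟩
      · have hi : l.get i ∈ (c * v) ::ₘ t' := by
          rw [← hl]
          exact List.get_mem l i
        rcases Multiset.mem_cons.1 hi with h | h
        · rw [h]
          exact (irreducible_mul_units v).2 (ht c (Multiset.mem_cons_self _ _))
        · exact ht _ (Multiset.mem_cons_of_mem h)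
      · rw [← List.prod_ofFn, List.ofFn_get, ← Multiset.prod_coe, hl, Multiset.prod_cons, ← hv,
          Multiset.prod_cons, mul_right_comm]

theorem Associates.closure_irreducible {H : Type*} [CancelCommMonoid H]
    [Monoid.FG (Associates H)] :
    Submonoid.closure {u : Associates H | Irreducible u} = ⊤ :=
  letI : CancelCommMonoid (Associates H) :=
    { Associates.instCommMonoid with
      mul_left_cancel := fun _ _ _ => Associates.mul_left_cancel_of_cancelCommMonoid }
  Submonoid.closure_irreducible

/-- The model of factorizations given by the free commutative monoid on the irreducible elements
of the reduced monoid. -/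
noncomputable def LengthModel.ofAtoms (H : Type*) [CancelCommMonoid H]
    [Monoid.FG (Associates H)] :
    LengthModel H ({u : Associates H // Irreducible u} →₀ ℕ) where
  val x := ((Finsupp.toMultiset x).map Subtype.val).prod
  len := Multiset.cardHom.comp Finsupp.toMultiset
  val_zero := by simp
  val_add := by simp
  val_surjective := by
    classical
    intro a
    obtain ⟨s, hs, rfl⟩ := Submonoid.exists_multiset_of_mem_closure
      (Associates.closure_irreducible (H := H) ▸ Submonoid.mem_top a)
    lift s to Multiset {u : Associates H // Irreducible u} using hs
    exact ⟨Multiset.toFinsupp s, by simp⟩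
  eq_zero_of_val := by
    classical
    intro x hx
    have h : Finsupp.toMultiset x = 0 := by
      refine Multiset.eq_zero_of_forall_notMem fun u hu => u.2.not_isUnit ?_
      exact isUnit_of_dvd_one (hx ▸ Multiset.dvd_prod (Multiset.mem_map_of_mem _ hu))
    simpa using Finsupp.toMultiset_eq_iff.1 h
  eq_zero_of_len := by
    classical
    intro x hx
    have h : Finsupp.toMultiset x = 0 := Multiset.card_eq_zero.1 hx
    simpa using Finsupp.toMultiset_eq_iff.1 h
  mem_lengthSet := by
    classical
    intro a k
    rw [mem_lengthSet_iff_s12]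
    constructor
    · rintro ⟨s, hs, h, rfl⟩
      lift s to Multiset {u : Associates H // Irreducible u} using hs
      exact ⟨Multiset.toFinsupp s, by simpa using h, by simp⟩
    · rintro ⟨x, hx, rfl⟩
      refine ⟨(Finsupp.toMultiset x).map Subtype.val, ?_, hx, by simp⟩
      intro u hu
      obtain ⟨v, -, rfl⟩ := Multiset.mem_map.1 hu
      exact v.2

/-- The smallest asymptotic elasticity is attained. -/
theorem exists_hasConstElasticity_min (H : Type*) [CancelCommMonoid H]
    [Monoid.FG (Associates H)] (hne : ∃ a : H, ¬ IsUnit a) :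
    ∃ (c : H) (q : ℚ), HasConstElasticity H c q ∧
      ∀ (d : H) (r : ℝ), HasConstElasticity H d r → q ≤ r := by
  have hfin : {u : Associates H | Irreducible u}.Finite := finite_irreducible
  have : Finite {u : Associates H // Irreducible u} := hfin
  let m := LengthModel.ofAtoms H
  have hpow : ∀ u : {u : Associates H // Irreducible u}, ∃ (c : H) (k : ℕ)
      (x y : {u : Associates H // Irreducible u} →₀ ℕ), 0 < k ∧ m.val x = u.1 ^ k ∧
      m.val y = u.1 ^ k ∧ 0 < m.len y ∧
      HasConstElasticity H c (((m.len x : ℚ) / m.len y : ℚ) : ℝ) := by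
    rintro ⟨u, hu⟩
    obtain ⟨a, rfl⟩ := Associates.mk_surjective u
    have ha : ¬ IsUnit a := fun h => hu.not_isUnit (Associates.isUnit_mk.2 h)
    obtain ⟨k, x, y, hk, hx, hy, hc⟩ := m.exists_pow_hasConstElasticity ha
    exact ⟨a ^ k, k, x, y, hk, by rw [hx, Associates.mk_pow], by rw [hy, Associates.mk_pow],
      m.len_pos hc.1 hy, by simpa using hc⟩
  choose c k x y hk hx hy hpos hc using hpow
  have hnonempty : Nonempty {u : Associates H // Irreducible u} := by
    by_contra hcon
    obtain ⟨a, ha⟩ := hne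
    have hempty : {u : Associates H | Irreducible u} = ∅ :=
      Set.eq_empty_of_forall_notMem fun u hu => hcon ⟨⟨u, hu⟩⟩
    have htop := Associates.closure_irreducible (H := H)
    rw [hempty, Submonoid.closure_empty] at htop
    have hmem : Associates.mk a ∈ (⊥ : Submonoid (Associates H)) := htop ▸ Submonoid.mem_top _
    exact ha (Associates.mk_eq_one.1 (Submonoid.mem_bot.1 hmem))
  obtain ⟨u₀, hu₀⟩ := Finite.exists_min fun u => (m.len (x u) : ℚ) / m.len (y u)
  refine ⟨c u₀, _, hc u₀, fun d r hd => ?_⟩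
  refine m.le_of_hasConstElasticity Associates.closure_irreducible (fun u hu => ?_) hd
  refine ⟨k ⟨u, hu⟩, x ⟨u, hu⟩, y ⟨u, hu⟩, hk _, hx _, hy _, ?_⟩
  have hpos' : (0 : ℚ) < m.len (y ⟨u, hu⟩) := by exact_mod_cast hpos ⟨u, hu⟩
  have h := (le_div_iff₀ hpos').1 (hu₀ ⟨u, hu⟩)
  exact_mod_cast h

/-- If `H_red = H/H^×` is finitely generated and `H ≠ H^×`, then
`R̄(H)` is exactly the set of rationals in the interval `[inf R̄(H), sup R̄(H)]`
(and `sup R̄(H) = ρ(H)`). -/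
theorem statement12 (H : Type*) [CancelCommMonoid H]
    (hfg : Monoid.FG (Associates H)) (hne : ∃ a : H, ¬ IsUnit a) :
    asympSet H = {r : EReal | (∃ q : ℚ, r = ((q : ℝ) : EReal)) ∧
        sInf (asympSet H) ≤ r ∧ r ≤ sSup (asympSet H)} ∧
      sSup (asympSet H) = monoidElasticity H := by
  have hfin : {u : Associates H | Irreducible u}.Finite := finite_irreducible
  have : Finite {u : Associates H // Irreducible u} := hfin
  let m := LengthModel.ofAtoms H
  obtain ⟨c₁, q₁, hc₁, hmax⟩ := m.exists_hasConstElasticity_max hne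
  obtain ⟨c₀, q₀, hc₀, hmin⟩ := exists_hasConstElasticity_min H hne
  have hsup : IsGreatest (asympSet H) ((q₁ : ℝ) : EReal) := by
    refine ⟨(m.mem_asympSet_iff _).2 ⟨c₁, q₁, hc₁, rfl⟩, fun r hr => ?_⟩
    obtain ⟨c, q, hc, rfl⟩ := (m.mem_asympSet_iff r).1 hr
    rw [← hc.2 1 one_pos]
    exact EReal.coe_le_coe_iff.2 (hmax _)
  have hinf : IsLeast (asympSet H) ((q₀ : ℝ) : EReal) := by
    refine ⟨(m.mem_asympSet_iff _).2 ⟨c₀, q₀, hc₀, rfl⟩, fun r hr => ?_⟩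
    obtain ⟨c, q, hc, rfl⟩ := (m.mem_asympSet_iff r).1 hr
    exact EReal.coe_le_coe_iff.2 (hmin c q hc)
  constructor
  · ext r
    constructor
    · intro hr
      obtain ⟨c, q, hc, h⟩ := (m.mem_asympSet_iff r).1 hr
      exact ⟨⟨q, h⟩, sInf_le hr, le_sSup hr⟩
    · rintro ⟨⟨q, rfl⟩, h₀, h₁⟩
      rw [hinf.isGLB.sInf_eq] at h₀
      rw [hsup.isLUB.sSup_eq] at h₁
      rcases h₀.eq_or_lt with h₀ | h₀
      · exact h₀ ▸ hinf.1
      rcases h₁.eq_or_lt with h₁ | h₁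
      · exact h₁ ▸ hsup.1
      obtain ⟨c, hc⟩ := m.exists_hasConstElasticity_between hc₀ hc₁ (EReal.coe_lt_coe_iff.1 h₀)
        (EReal.coe_lt_coe_iff.1 h₁)
      exact (m.mem_asympSet_iff _).2 ⟨c, q, hc, rfl⟩
  · rw [hsup.isLUB.sSup_eq, monoidElasticity]
    apply le_antisymm
    · have h := hc₁.2 1 one_pos
      rw [← h]
      exact le_iSup (fun a : H => ((elasticity H a : ℝ) : EReal)) _
    · exact iSup_le fun a => EReal.coe_le_coe_iff.2 (hmax a)
end
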